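/- (Equation (fuchsY).) Fix i ∈ {1,…,L} and a generic point λ ∈ ℂ^L with det(W_i) ≠ 0. Let Z : ℂ^L → ℂ be differentiable at λ and suppose that for every n ∈ {1,…,L} (with the conventions ω^{(i)}_{ij} := ω_{ij} and h^{(i)}_i := h_i) the equation η · ∂Z/∂λ_i(λ) = Σ_{j=1, j≠i}^L ω^{(n)}_{ij}(λ) · Z(λ[λ_j := λ_i]) + h^{(n)}_i(λ) · Z(λ) holds, where λ[λ_j := λ_i] denotes λ with its j-th entry replaced by λ_i. Then det(Y_i) · ∂Z/∂λ_i(λ) = det(Ȳ_i) · Z(λ); in particular, if det(Y_i) ≠ 0 then ∂Z/∂λ_i(λ) = ( det(Ȳ_i)/det(Y_i) ) · Z(λ). -/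

import Mathlib

open Finset Function

noncomputable section

/-- A point `λ ∈ ℂ^L` is generic: the `λ_j` are pairwise distinct, `λ_j - λ_k + η ≠ 0`
for `j ≠ k`, and `λ_j - μ_k + η ≠ 0` for all `j, k`. -/
def Generic {L : ℕ} (η : ℂ) (μ lam : Fin L → ℂ) : Prop :=
  (∀ j k : Fin L, j ≠ k → lam j ≠ lam k) ∧
  (∀ j k : Fin L, j ≠ k → lam j - lam k + η ≠ 0) ∧
  (∀ j k : Fin L, lam j - μ k + η ≠ 0)

/-- The coefficient `ω_{ij}` of (KZE).  Weights: `a x = x + η`, `b x = x`, `c x = η`. -/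
def omegaKZE {L : ℕ} (η : ℂ) (μ lam : Fin L → ℂ) (i j : Fin L) : ℂ :=
  η / (lam j - lam i + η) * ((lam i - lam j + η) / (lam i - lam j)) *
    (∏ k, (lam j - μ k + η) / (lam i - μ k + η)) *
    ∏ k ∈ univ \ {i, j},
      (lam k - lam i) / (lam k - lam i + η) * ((lam k - lam j + η) / (lam k - lam j))

/-- The coefficient `h_i` of (KZE). -/
def hKZE {L : ℕ} (η : ℂ) (μ lam : Fin L → ℂ) (i : Fin L) : ℂ :=
  (∏ k, (lam i - μ k) / (lam i - μ k + η)) *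
      ∏ k ∈ univ.erase i, (lam k - lam i) / (lam k - lam i + η) +
    ∑ k, η / (lam i - μ k + η) +
    ∑ k ∈ univ.erase i, η ^ 2 / ((lam k - lam i) * (lam k - lam i + η)) - 1

/-- The coefficient `ω^{(n)}_{ij}` of the family (KZF) (for `n ≠ i`, `j ≠ i`), the case
`j = n` carrying the special coefficient `ω^{(n)}_{in}`. -/
def omegaFam {L : ℕ} (η : ℂ) (μ lam : Fin L → ℂ) (n i j : Fin L) : ℂ :=
  if j = n then
    η⁻¹ * (∏ k, (lam i - μ k + η)⁻¹) *
      (∏ k ∈ univ \ {i, n}, (lam k - lam i) / (lam k - lam i + η)) *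
      ((lam n - lam i) * ∏ k, (lam n - μ k) +
        (lam i - lam n + η) ^ 2 / (lam i - lam n) * (∏ k, (lam n - μ k + η)) *
          ∏ k ∈ univ \ {i, n}, (lam k - lam n + η) / (lam k - lam n))
  else
    (lam i - lam j + η) / (lam j - lam i) * ((lam n - lam i + η) / (lam n - lam j + η)) *
      (∏ k, (lam j - μ k + η) / (lam i - μ k + η)) *
      (∏ k ∈ univ.erase i, (lam k - lam i) / (lam k - lam i + η)) *
      ∏ k ∈ univ.erase j, (lam k - lam j + η) / (lam k - lam j)

/-- The coefficient `h^{(n)}_i` of the family (KZF), for `n ≠ i`. -/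
def hFam {L : ℕ} (η : ℂ) (μ lam : Fin L → ℂ) (n i : Fin L) : ℂ :=
  ∑ j ∈ univ \ {i, n}, η ^ 2 / ((lam j - lam i) * (lam j - lam i + η)) +
    ∑ j, η / (lam i - μ j + η) - (lam i - lam n + η) / (lam i - lam n) - 1

/-- `ω^{(n)}_{ij}` with the convention `ω^{(i)}_{ij} := ω_{ij}`. -/
def Omega {L : ℕ} (η : ℂ) (μ lam : Fin L → ℂ) (n i j : Fin L) : ℂ :=
  if n = i then omegaKZE η μ lam i j else omegaFam η μ lam n i j

/-- `h^{(n)}_i` with the convention `h^{(i)}_i := h_i`. -/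
def Hcoef {L : ℕ} (η : ℂ) (μ lam : Fin L → ℂ) (n i : Fin L) : ℂ :=
  if n = i then hKZE η μ lam i else hFam η μ lam n i

/-- The `L × L` matrix `K_i`: entry `(n, j)` is `ω^{(n)}_{ij}` for `j ≠ i` and the column
`i` is constant equal to `η` (`= c`). -/
def Kmat {L : ℕ} (η : ℂ) (μ lam : Fin L → ℂ) (i : Fin L) : Matrix (Fin L) (Fin L) ℂ :=
  fun n j => if j = i then η else Omega η μ lam n i j

/-- The `L × L` matrix `K̄_i`: as `K_i` but with column `i` entries `h^{(n)}_i`. -/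
def Kbar {L : ℕ} (η : ℂ) (μ lam : Fin L → ℂ) (i : Fin L) : Matrix (Fin L) (Fin L) ℂ :=
  fun n j => if j = i then Hcoef η μ lam n i else Omega η μ lam n i j

/-- The reduced coefficient `ω̄^{(n)}_{ij}` of Eq. (BW) (for `j ≠ i`), the case `j = n`
carrying the special coefficient `ω̄^{(n)}_{in}`. -/
def omegaBar {L : ℕ} (η : ℂ) (μ lam : Fin L → ℂ) (n i j : Fin L) : ℂ :=
  if j = n then
    (lam n - lam i + η) / η *
      ((∏ k, (lam n - μ k)) -
        ((lam i - lam n + η) / (lam i - lam n)) ^ 2 * (∏ k, (lam n - μ k + η)) *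
          ∏ k ∈ univ \ {i, n}, (lam k - lam n + η) / (lam k - lam n))
  else
    (lam i - lam j + η) / (lam j - lam i) * ((lam n - lam i + η) / (lam n - lam j + η)) *
      (∏ k, (lam j - μ k + η)) *
      ∏ k ∈ univ.erase j, (lam k - lam j + η) / (lam k - lam j)

/-- The matrix `Y_i`: `K_i` with every entry `ω^{(n)}_{ij}` replaced by `ω̄^{(n)}_{ij}`. -/
def Ymat {L : ℕ} (η : ℂ) (μ lam : Fin L → ℂ) (i : Fin L) : Matrix (Fin L) (Fin L) ℂ :=
  fun n j => if j = i then η else omegaBar η μ lam n i j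

/-- The matrix `Ȳ_i`: `K̄_i` with every entry `ω^{(n)}_{ij}` replaced by `ω̄^{(n)}_{ij}`. -/
def Ybar {L : ℕ} (η : ℂ) (μ lam : Fin L → ℂ) (i : Fin L) : Matrix (Fin L) (Fin L) ℂ :=
  fun n j => if j = i then Hcoef η μ lam n i else omegaBar η μ lam n i j

/-- The `(L-1) × (L-1)` matrix `W_i`, rows `n ≠ i`, columns `j ≠ i`, entries `ω^{(n)}_{ij}`. -/
def Wmat {L : ℕ} (η : ℂ) (μ lam : Fin L → ℂ) (i : Fin L) :
    Matrix {n : Fin L // n ≠ i} {j : Fin L // j ≠ i} ℂ :=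
  fun n j => omegaFam η μ lam (n : Fin L) i (j : Fin L)

/-- The factor by which `ω^{(n)}_{ij}` and `ω̄^{(n)}_{ij}` differ; it depends on `i` only. -/
def reductionFactor {L : ℕ} (η : ℂ) (μ lam : Fin L → ℂ) (i : Fin L) : ℂ :=
  (∏ k, (lam i - μ k + η)⁻¹) * ∏ k ∈ univ.erase i, (lam k - lam i) / (lam k - lam i + η)

theorem prod_erase_eq_mul_prod_sdiff_pair {ι M : Type*} [Fintype ι] [DecidableEq ι]
    [CommMonoid M] {i j : ι} (hij : j ≠ i) (f : ι → M) :
    ∏ k ∈ univ.erase i, f k = f j * ∏ k ∈ univ \ {i, j}, f k := by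
  rw [← Finset.mul_prod_erase (univ.erase i) f (by simp [hij] : j ∈ univ.erase i)]
  congr 2
  ext k
  simp [and_comm]

theorem omegaKZE_eq_reductionFactor_mul {L : ℕ} {η : ℂ} {μ lam : Fin L → ℂ}
    (hgen : Generic η μ lam) {i j : Fin L} (hj : j ≠ i) :
    omegaKZE η μ lam i j = reductionFactor η μ lam i * omegaBar η μ lam i i j := by
  have hb : lam j - lam i ≠ 0 := sub_ne_zero.2 (hgen.1 j i hj)
  have hb' : lam i - lam j ≠ 0 := sub_ne_zero.2 (hgen.1 i j hj.symm)
  have ha : lam j - lam i + η ≠ 0 := hgen.2.1 j i hj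
  have ha' : lam i - lam j + η ≠ 0 := hgen.2.1 i j hj.symm
  rw [omegaKZE, omegaBar, reductionFactor, if_neg hj,
    prod_erase_eq_mul_prod_sdiff_pair hj,
    prod_erase_eq_mul_prod_sdiff_pair hj.symm, Finset.pair_comm j i]
  simp only [div_eq_mul_inv (_ : ℂ) (lam i - μ _ + η), Finset.prod_mul_distrib, sub_self,
    zero_add]
  field_simp

theorem omegaFam_eq_reductionFactor_mul {L : ℕ} {η : ℂ} {μ lam : Fin L → ℂ}
    (hgen : Generic η μ lam) {n i : Fin L} (hn : n ≠ i) (j : Fin L) :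
    omegaFam η μ lam n i j = reductionFactor η μ lam i * omegaBar η μ lam n i j := by
  rw [omegaFam, omegaBar, reductionFactor]
  split_ifs with h
  · have hb : lam n - lam i ≠ 0 := sub_ne_zero.2 (hgen.1 n i hn)
    have ha : lam n - lam i + η ≠ 0 := hgen.2.1 n i hn
    rw [prod_erase_eq_mul_prod_sdiff_pair hn, ← neg_sub (lam n) (lam i)]
    field_simp
    ring
  · simp only [div_eq_mul_inv (_ : ℂ) (lam i - μ _ + η), Finset.prod_mul_distrib]
    ring

theorem Omega_eq_reductionFactor_mul {L : ℕ} {η : ℂ} {μ lam : Fin L → ℂ}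
    (hgen : Generic η μ lam) (n : Fin L) {i j : Fin L} (hj : j ≠ i) :
    Omega η μ lam n i j = reductionFactor η μ lam i * omegaBar η μ lam n i j := by
  rw [Omega]
  split_ifs with h
  · rw [h, omegaKZE_eq_reductionFactor_mul hgen hj]
  · exact omegaFam_eq_reductionFactor_mul hgen h j

/-- Cramer's rule, without invertibility assumption. -/
theorem det_mul_eq_det_updateCol_mulVec {ι R : Type*} [Fintype ι] [DecidableEq ι] [CommRing R]
    (A : Matrix ι ι R) (v : ι → R) (i : ι) :
    A.det * v i = (A.updateCol i (A.mulVec v)).det := by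
  rw [← Matrix.cramer_apply, Matrix.cramer_eq_adjugate_mulVec, Matrix.mulVec_mulVec,
    Matrix.adjugate_mul, Matrix.smul_mulVec, Matrix.one_mulVec, Pi.smul_apply, smul_eq_mul]

/-- Eq. (fuchsY): if `det W_i ≠ 0` and `Z`, differentiable at the generic
point `λ`, satisfies `η ∂_i Z = Σ_{j≠i} ω^{(n)}_{ij} Z(λ[λ_j := λ_i]) + h^{(n)}_i Z` for
every `n` (with the conventions `ω^{(i)}_{ij} := ω_{ij}`, `h^{(i)}_i := h_i`), then
`det Y_i · ∂_i Z = det Ȳ_i · Z`; in particular `∂_i Z = (det Ȳ_i / det Y_i) Z` when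
`det Y_i ≠ 0`. -/
theorem fuchsY {L : ℕ} (hL : 2 ≤ L) (η : ℂ) (hη : η ≠ 0) (μ : Fin L → ℂ)
    (lam : Fin L → ℂ) (hgen : Generic η μ lam) (i : Fin L)
    (hW : (Wmat η μ lam i).det ≠ 0)
    (Z : (Fin L → ℂ) → ℂ) (hZ : DifferentiableAt ℂ Z lam)
    (hsys : ∀ n : Fin L,
      η * fderiv ℂ Z lam (Pi.single i 1) =
        ∑ j ∈ univ.erase i, Omega η μ lam n i j * Z (Function.update lam j (lam i)) +
          Hcoef η μ lam n i * Z lam) :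
    (Ymat η μ lam i).det * fderiv ℂ Z lam (Pi.single i 1) =
        (Ybar η μ lam i).det * Z lam ∧
      ((Ymat η μ lam i).det ≠ 0 →
        fderiv ℂ Z lam (Pi.single i 1) =
          (Ybar η μ lam i).det / (Ymat η μ lam i).det * Z lam) := by
  have key : (Ymat η μ lam i).det * fderiv ℂ Z lam (Pi.single i 1) =
      (Ybar η μ lam i).det * Z lam := by
    let v : Fin L → ℂ := fun j => if j = i then fderiv ℂ Z lam (Pi.single i 1)
      else -(reductionFactor η μ lam i * Z (Function.update lam j (lam i)))
    have hv : (Ymat η μ lam i).mulVec v = Z lam • fun n => Hcoef η μ lam n i := by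
      funext n
      have hsum : ∑ j ∈ univ.erase i, Ymat η μ lam i n j * v j =
          -∑ j ∈ univ.erase i,
            Omega η μ lam n i j * Z (Function.update lam j (lam i)) := by
        rw [← Finset.sum_neg_distrib]
        refine Finset.sum_congr rfl fun j hj => ?_
        have hji : j ≠ i := Finset.ne_of_mem_erase hj
        simp only [Ymat, v, if_neg hji, Omega_eq_reductionFactor_mul hgen n hji]
        ring
      rw [Matrix.mulVec, dotProduct, ← Finset.add_sum_erase univ _ (Finset.mem_univ i), hsum]
      simp only [Ymat, v, if_true, Pi.smul_apply, smul_eq_mul]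
      linear_combination hsys n
    have hbar : (Ymat η μ lam i).updateCol i (fun n => Hcoef η μ lam n i) =
        Ybar η μ lam i := by
      ext n j
      by_cases h : j = i <;> simp [Ymat, Ybar, h]
    have h := det_mul_eq_det_updateCol_mulVec (Ymat η μ lam i) v i
    rw [hv, Matrix.det_updateCol_smul, hbar] at h
    simpa only [v, if_true, mul_comm (Z lam)] using h
  refine ⟨key, fun hY => ?_⟩
  rw [div_mul_eq_mul_div, eq_div_iff hY, mul_comm, key]
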